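/- For every ε > 0 there exist irrational numbers α, β ∈ [0,1/2] such that M(α,β) < ε. -/

import Mathlib

open MeasureTheory
open scoped Classical ENNReal

/-- The lattice `Λ ⊂ ℝ²` generated by `(1/2, 1/2)` and `(−1/2, 1/2)`. -/
noncomputable def Lam : AddSubgroup (ℝ × ℝ) :=
  AddSubgroup.closure {((1:ℝ)/2, (1:ℝ)/2), (-((1:ℝ)/2), (1:ℝ)/2)}

/-- The torus `Y = ℝ²/Λ`. -/
noncomputable abbrev Y : Type := (ℝ × ℝ) ⧸ Lam

/-- `N = {(1,0), (−1,0), (0,1), (0,−1)} ⊂ ℤ²`. -/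
def Nset : Set (ℤ × ℤ) := {(1, 0), (-1, 0), (0, 1), (0, -1)}

/-- The canonical representative of a point of `ℝ²` in the fundamental domain
`[0,1/2) × [0,1)` of `Λ`. -/
noncomputable def fundRep (p : ℝ × ℝ) : ℝ × ℝ :=
  if Even ⌊2 * p.1⌋ then (p.1 - (⌊2 * p.1⌋ : ℝ) / 2, Int.fract p.2)
  else (p.1 - (⌊2 * p.1⌋ : ℝ) / 2, Int.fract (p.2 - 1/2))

/-- The sign `s ∈ {1,−1}` attached to a point of `Y`: `s = 1` if the representative of the
point in the fundamental domain lies in `A₁ = [0,1/2) × [0,1/2)`, and `s = −1` otherwise. -/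
noncomputable def sgn (q : Y) : ℤ :=
  if (fundRep q.out).2 < 1/2 then 1 else -1

/-- The rectangle exchange map `Ψ_{α,β}` on `Y × N`:
`Ψ((x,y),(a,b)) = ((x + b·s·α, y + a·s·β) mod Λ, (b·s, a·s))`. -/
noncomputable def Psi (α β : ℝ) (p : Y × (ℤ × ℤ)) : Y × (ℤ × ℤ) :=
  (p.1 + (QuotientAddGroup.mk (((p.2.2 * sgn p.1 : ℤ) : ℝ) * α,
      ((p.2.1 * sgn p.1 : ℤ) : ℝ) * β) : Y),
    (p.2.2 * sgn p.1, p.2.1 * sgn p.1))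

/-- Normalized Lebesgue (Haar) measure on `Y`: the pushforward of twice Lebesgue measure
restricted to the fundamental domain `[0,1/2) × [0,1)`; it has total mass `1`. -/
noncomputable def mY : Measure Y :=
  Measure.map (QuotientAddGroup.mk : ℝ × ℝ → Y)
    ((2 : ℝ≥0∞) • volume.restrict (Set.Ico (0:ℝ) (1/2) ×ˢ Set.Ico (0:ℝ) 1))

/-- The uniform probability measure on `N`, assigning mass `1/4` to each of the four
elements of `N`. -/
noncomputable def mN : Measure (ℤ × ℤ) :=
  (4 : ℝ≥0∞)⁻¹ • (Measure.dirac ((1:ℤ), (0:ℤ)) + Measure.dirac ((-1:ℤ), (0:ℤ)) +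
    Measure.dirac ((0:ℤ), (1:ℤ)) + Measure.dirac ((0:ℤ), (-1:ℤ)))

/-- The measure `λ` on `Y × N`, normalized so that `λ(Y × N) = 1`. -/
noncomputable def lamMeas : Measure (Y × (ℤ × ℤ)) := mY.prod mN

/-- `M(α,β)`: the `λ`-measure of the set of periodic points of `Ψ_{α,β}`. -/
noncomputable def Mab (α β : ℝ) : ℝ≥0∞ :=
  lamMeas {p : Y × (ℤ × ℤ) | ∃ n : ℕ, 1 ≤ n ∧ (Psi α β)^[n] p = p}

open Set

/-! ### The square wave and the double cover of `Ψ` -/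

/-- The `1`-periodic square wave: `1` on `[0, 1/2)` and `-1` on `[1/2, 1)`. -/
noncomputable def squareWave (x : ℝ) : ℤ := if Even ⌊2 * x⌋ then 1 else -1

lemma squareWave_eq_or (x : ℝ) : squareWave x = 1 ∨ squareWave x = -1 := by
  unfold squareWave; split_ifs <;> simp

lemma squareWave_add_half (x : ℝ) : squareWave (x + 1 / 2) = -squareWave x := by
  have h : ⌊2 * (x + 1 / 2)⌋ = ⌊2 * x⌋ + 1 := by
    rw [← Int.floor_add_one]; congr 1; ring
  unfold squareWave
  rw [h]
  by_cases he : Even ⌊2 * x⌋ <;> simp [he]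

lemma squareWave_periodic : Function.Periodic squareWave 1 := fun x => by
  have h := squareWave_add_half (x + 1 / 2)
  rw [squareWave_add_half x, neg_neg] at h
  rw [← h]; congr 1; ring

lemma squareWave_eq_one {x : ℝ} (h0 : 0 ≤ x) (h1 : x < 1 / 2) : squareWave x = 1 := by
  have h : ⌊2 * x⌋ = 0 := by rw [Int.floor_eq_iff]; constructor <;> push_cast <;> linarith
  simp [squareWave, h]

lemma squareWave_eq_neg_one {x : ℝ} (h0 : -(1 / 2) ≤ x) (h1 : x < 0) : squareWave x = -1 := by
  rw [← neg_inj, ← squareWave_add_half, neg_neg]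
  exact squareWave_eq_one (by linarith) (by linarith)

lemma measurable_squareWave : Measurable squareWave := by
  have h : squareWave = (fun k : ℤ => if Even k then (1 : ℤ) else -1) ∘ fun x : ℝ => ⌊2 * x⌋ := rfl
  rw [h]
  exact (measurable_of_countable _).comp (Int.measurable_floor.comp (measurable_const_mul 2))

/-- The square wave on the circle `ℝ/ℤ`. -/
noncomputable def circleWave : UnitAddCircle → ℤ := squareWave_periodic.lift

@[simp]
lemma circleWave_coe (x : ℝ) : circleWave (x : UnitAddCircle) = squareWave x :=
  squareWave_periodic.lift_coe x

lemma circleWave_eq_or (z : UnitAddCircle) : circleWave z = 1 ∨ circleWave z = -1 := by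
  induction z using QuotientAddGroup.induction_on with
  | H x => simpa using squareWave_eq_or x

lemma measurable_circleWave : Measurable circleWave := by
  intro s hs
  exact measurable_squareWave hs

/-- The state space of the lift of `Ψ` to the double cover `(ℝ/ℤ)²` of `Y`. -/
abbrev CoverState : Type := (UnitAddCircle × UnitAddCircle) × (ℤ × ℤ)

/-- The lift of `Ψ_{α,β}` to `(ℝ/ℤ)² × ℤ²`. -/
noncomputable def coverMap (α β : ℝ) (p : CoverState) : CoverState :=
  ((p.1.1 + ((((p.2.2 * (circleWave p.1.1 * circleWave p.1.2) : ℤ) : ℝ) * α : ℝ) : UnitAddCircle),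
    p.1.2 + ((((p.2.1 * (circleWave p.1.1 * circleWave p.1.2) : ℤ) : ℝ) * β : ℝ) : UnitAddCircle)),
    (p.2.2 * (circleWave p.1.1 * circleWave p.1.2), p.2.1 * (circleWave p.1.1 * circleWave p.1.2)))

/-- The state at the point `(x, y)` of the torus, entered in direction `d`. -/
def coverState (x y : ℝ) (d : ℤ × ℤ) : CoverState := (((x : UnitAddCircle), (y : UnitAddCircle)), d)

lemma coverMap_coverState (α β x y : ℝ) (a b : ℤ) :
    coverMap α β (coverState x y (a, b)) =
      coverState (x + ((b * (squareWave x * squareWave y) : ℤ) : ℝ) * α)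
        (y + ((a * (squareWave x * squareWave y) : ℤ) : ℝ) * β)
        (b * (squareWave x * squareWave y), a * (squareWave x * squareWave y)) := by
  simp [coverMap, coverState]

lemma coverState_eq_coverState {x x' y y' : ℝ} {d d' : ℤ × ℤ} (k l : ℤ) (hx : x' = x + k)
    (hy : y' = y + l) (hd : d' = d) : coverState x' y' d' = coverState x y d := by
  subst hx hy hd
  simp [coverState]

/-- The interchange of the two coordinates. -/
def stateSwap (p : CoverState) : CoverState := (p.1.swap, p.2.swap)

lemma stateSwap_coverMap (α β : ℝ) :
    Function.Semiconj stateSwap (coverMap α β) (coverMap β α) := fun p => by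
  simp [stateSwap, coverMap, mul_comm (circleWave p.1.1)]

/-! ### Excursions outside a set -/

/-- The orbit of `s` under `T` reaches `s'` after `n` steps, staying outside `A` before that. -/
def Passes {X : Type*} (T : X → X) (A : Set X) (n : ℕ) (s s' : X) : Prop :=
  T^[n] s = s' ∧ ∀ j < n, T^[j] s ∉ A

namespace Passes

variable {X : Type*} {T : X → X} {A : Set X}

lemma refl (s : X) : Passes T A 0 s s := ⟨rfl, by simp⟩

lemma step {s : X} (hs : s ∉ A) : Passes T A 1 s (T s) :=
  ⟨rfl, fun j hj => by obtain rfl : j = 0 := by omega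
                       exact hs⟩

lemma trans {m n : ℕ} {s s' s'' : X} (h : Passes T A m s s') (h' : Passes T A n s' s'') :
    Passes T A (m + n) s s'' := by
  refine ⟨?_, fun j hj => ?_⟩
  · rw [add_comm, Function.iterate_add_apply, h.1, h'.1]
  · rcases lt_or_ge j m with hjm | hjm
    · exact h.2 j hjm
    · obtain ⟨i, rfl⟩ := Nat.exists_eq_add_of_le hjm
      rw [add_comm, Function.iterate_add_apply, h.1]
      exact h'.2 i (by omega)

lemma semiconj {Z : Type*} {U : Z → Z} {g : X → Z} (hg : Function.Semiconj g T U) {B : Set Z}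
    (hAB : ∀ x, g x ∈ B → x ∈ A) {n : ℕ} {s s' : X} (h : Passes T A n s s') :
    Passes U B n (g s) (g s') := by
  refine ⟨?_, fun j hj hB => h.2 j hj (hAB _ ?_)⟩
  · rw [← h.1]; exact ((hg.iterate_right n) s).symm
  · rwa [(hg.iterate_right j) s]

end Passes

/-- The image in `ℝ/ℤ` of the interval `[-c/2, c/2)`. -/
def arc (c : ℝ) : Set UnitAddCircle := (fun x : ℝ => (x : UnitAddCircle)) '' Ico (-(c / 2)) (c / 2)

lemma coe_notMem_arc {c x : ℝ} (k : ℤ) (h0 : c / 2 ≤ x + k) (h1 : x + k < 1 - c / 2) :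
    (x : UnitAddCircle) ∉ arc c := by
  rintro ⟨y, hy, hxy⟩
  obtain ⟨m, hm⟩ := (AddCircle.coe_eq_zero_iff (1 : ℝ)).1
    (show ((y - x : ℝ) : UnitAddCircle) = 0 by simpa [sub_eq_zero] using hxy)
  obtain ⟨hy0, hy1⟩ := hy
  simp only [zsmul_eq_mul, mul_one] at hm
  have h2 : (-1 : ℝ) < ((m - k : ℤ) : ℝ) := by push_cast; linarith
  have h3 : ((m - k : ℤ) : ℝ) < 0 := by push_cast; linarith
  norm_cast at h2 h3
  omega

/-! ### Passing through a bump of the column walk -/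

section bump

variable {α β : ℝ} {A : Set CoverState} {ε τ κ : ℤ}

lemma passes_slope (hε : ε * ε = 1) (hτ : τ * τ = 1) (hκ : κ * κ = 1) {X y : ℝ} {b : ℕ}
    (hA : ∀ i < b, ∀ y' d, coverState (X + i * (ε * α)) y' d ∉ A)
    (hX : ∀ i < b, squareWave (X + i * (ε * α)) = κ * ε)
    (hy : ∀ j ≤ b, squareWave (y + j * (κ * τ * β)) = τ) :
    Passes (coverMap α β) A (2 * b) (coverState X y (ε, 0))
      (coverState (X + b * (ε * α)) (y + b * (κ * τ * β)) (ε, 0)) := by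
  induction b with
  | zero => simpa using Passes.refl _
  | succ b ih =>
    have h1 := ih (fun i hi => hA i (by omega)) (fun i hi => hX i (by omega))
      (fun j hj => hy j (by omega))
    have hs : κ * ε * τ * ε = κ * τ := by linear_combination κ * τ * hε
    have hs' : κ * τ * (κ * ε * τ) = ε := by linear_combination ε * κ * κ * hτ + ε * hκ
    have e1 : coverMap α β (coverState (X + b * (ε * α)) (y + b * (κ * τ * β)) (ε, 0)) =
        coverState (X + b * (ε * α)) (y + (b + 1 : ℕ) * (κ * τ * β)) (0, κ * τ) := by
      rw [coverMap_coverState, hX b (by omega), hy b (by omega), mul_comm ε, hs]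
      congr 1
      · simp
      · push_cast; ring
      · simp
    have e2 : coverMap α β (coverState (X + b * (ε * α)) (y + (b + 1 : ℕ) * (κ * τ * β))
        (0, κ * τ)) =
        coverState (X + (b + 1 : ℕ) * (ε * α)) (y + (b + 1 : ℕ) * (κ * τ * β)) (ε, 0) := by
      rw [coverMap_coverState, hX b (by omega), hy (b + 1) le_rfl, hs']
      congr 1
      · push_cast; ring
      · simp
      · simp
    have h2 := Passes.step (T := coverMap α β) (hA b (by omega) (y + b * (κ * τ * β)) (ε, 0))
    have h3 := Passes.step (T := coverMap α β)
      (hA b (by omega) (y + (b + 1 : ℕ) * (κ * τ * β)) (0, κ * τ))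
    rw [e1] at h2
    rw [e2] at h3
    exact (h1.trans h2).trans h3

end bump

/-- The states whose position lies in `arc c × arc L`. -/
def core (c L : ℝ) : Set CoverState := {p | p.1.1 ∈ arc c ∧ p.1.2 ∈ arc L}

lemma coverState_notMem_core {c L x : ℝ} (k : ℤ) (h0 : c / 2 ≤ x + k) (h1 : x + k < 1 - c / 2)
    (y : ℝ) (d : ℤ × ℤ) : coverState x y d ∉ core c L :=
  fun h => coe_notMem_arc k h0 h1 h.1

section passage

variable {α β c L y : ℝ} {b : ℕ}

/-- A row of the core has `b` further rows of the same sign on the far side. -/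
lemma exists_sign_run (hβ : 0 < β) (hb : L = 1 - 2 * b * β)
    (hy : y ∈ Ico (-(L / 2)) (L / 2)) :
    ∃ τ : ℤ, τ * τ = 1 ∧ ∀ j ≤ b, squareWave (y + j * (τ * β)) = τ := by
  have hj {j : ℕ} (h : j ≤ b) : 0 ≤ j * β ∧ j * β ≤ b * β := by
    have : (j : ℝ) ≤ b := by exact_mod_cast h
    exact ⟨by positivity, by gcongr⟩
  obtain ⟨h0, h1⟩ := hy
  rcases le_or_gt 0 y with h | h
  · refine ⟨1, by norm_num, fun j hjb => squareWave_eq_one ?_ ?_⟩ <;> push_cast <;>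
      have := hj hjb <;> linarith
  · refine ⟨-1, by norm_num, fun j hjb => squareWave_eq_neg_one ?_ ?_⟩ <;> push_cast <;>
      have := hj hjb <;> linarith

/-- A path entering a bump of width `2 * b` crosses it and leaves in the same row. -/
lemma passes_bump (hα : 0 < α) (hβ : 0 < β) (hc : c = 1 - 2 * b * α) (hc0 : 0 < c)
    (hL : L = 1 - 2 * b * β) (hy : y ∈ Ico (-(L / 2)) (L / 2)) {X : ℝ} {ε : ℤ}
    (hX : ε = 1 ∧ c / 2 ≤ X ∧ X < c / 2 + α ∨ ε = -1 ∧ -(c / 2) - α ≤ X ∧ X < -(c / 2)) :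
    Passes (coverMap α β) (core c L) (4 * b) (coverState X y (ε, 0))
      (coverState (X - ε * c) y (ε, 0)) := by
  obtain ⟨τ, hτ, hτy⟩ := exists_sign_run hβ hL hy
  have hε : ε * ε = 1 := by rcases hX with h | h <;> simp [h.1]
  have hi {i : ℕ} (h : i < b) : 0 ≤ i * α ∧ i * α + α ≤ b * α := by
    have : (i : ℝ) + 1 ≤ b := by exact_mod_cast h
    exact ⟨by positivity, by nlinarith⟩
  have hup := passes_slope (α := α) (β := β) (A := core c L) (ε := ε) (τ := τ) (κ := 1)
    (X := X) (y := y) (b := b) hε hτ (by norm_num)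
    (fun i hib y' d => by
      have := hi hib
      rcases hX with ⟨rfl, h0, h1⟩ | ⟨rfl, h0, h1⟩
      · exact coverState_notMem_core 0 (by push_cast; linarith) (by push_cast; linarith) _ _
      · exact coverState_notMem_core 1 (by push_cast; linarith) (by push_cast; linarith) _ _)
    (fun i hib => by
      have := hi hib
      rcases hX with ⟨rfl, h0, h1⟩ | ⟨rfl, h0, h1⟩
      · exact squareWave_eq_one (by push_cast; linarith) (by push_cast; linarith)
      · exact squareWave_eq_neg_one (by push_cast; linarith) (by push_cast; linarith))
    (fun j hjb => by simpa using hτy j hjb)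
  have hdown := passes_slope (α := α) (β := β) (A := core c L) (ε := ε) (τ := τ) (κ := -1)
    (X := X + b * (ε * α)) (y := y + b * (τ * β)) (b := b) hε hτ (by norm_num)
    (fun i hib y' d => by
      have := hi hib
      rcases hX with ⟨rfl, h0, h1⟩ | ⟨rfl, h0, h1⟩
      · exact coverState_notMem_core 0 (by push_cast; linarith) (by push_cast; linarith) _ _
      · exact coverState_notMem_core 1 (by push_cast; linarith) (by push_cast; linarith) _ _)
    (fun i hib => by
      have := hi hib
      rcases hX with ⟨rfl, h0, h1⟩ | ⟨rfl, h0, h1⟩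
      · rw [← squareWave_periodic.sub_eq]
        exact squareWave_eq_neg_one (by push_cast; linarith) (by push_cast; linarith)
      · rw [← squareWave_periodic]
        exact squareWave_eq_one (by push_cast; linarith) (by push_cast; linarith))
    (fun j hjb => by
      have h := hτy (b - j) (by omega)
      rw [Nat.cast_sub hjb] at h
      convert h using 2
      push_cast; ring)
  have h := hup.trans (by simpa using hdown)
  rw [show 4 * b = 2 * b + 2 * b by ring]
  convert h using 1
  refine coverState_eq_coverState (-ε) 0 ?_ ?_ rfl
  · subst hc; push_cast; ring
  · push_cast; ring

/-- A path moving along a row of the core reaches the core again after crossing finitely many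
bumps. -/
lemma exists_passes_core (hα : 0 < α) (hβ : 0 < β) (hc : c = 1 - 2 * b * α) (hc0 : 0 < c)
    (hL : L = 1 - 2 * b * β) (hy : y ∈ Ico (-(L / 2)) (L / 2)) (n : ℕ) {X : ℝ}
    {ε : ℤ} (hX : ε = 1 ∧ -(c / 2) ≤ X ∧ X < c / 2 + α ∧ X < c / 2 + n * c ∨
      ε = -1 ∧ -(c / 2) - α ≤ X ∧ -(c / 2) - n * c ≤ X ∧ X < c / 2) :
    ∃ k : ℕ, X - ε * (k * c) ∈ Ico (-(c / 2)) (c / 2) ∧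
      (X ∉ Ico (-(c / 2)) (c / 2) → 1 ≤ k) ∧
      Passes (coverMap α β) (core c L) (4 * b * k) (coverState X y (ε, 0))
        (coverState (X - ε * (k * c)) y (ε, 0)) := by
  induction n generalizing X with
  | zero =>
    have h : X ∈ Ico (-(c / 2)) (c / 2) := by
      rcases hX with h | h <;> constructor <;> simp at h <;> linarith
    exact ⟨0, by simpa using h, fun h' => absurd h h', by simpa using Passes.refl _⟩
  | succ n ih =>
    by_cases h : X ∈ Ico (-(c / 2)) (c / 2)
    · exact ⟨0, by simpa using h, fun h' => absurd h h', by simpa using Passes.refl _⟩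
    have hstep : ε = 1 ∧ c / 2 ≤ X ∧ X < c / 2 + α ∨ ε = -1 ∧ -(c / 2) - α ≤ X ∧ X < -(c / 2) := by
      rcases hX with ⟨h1, h2, h3, h4⟩ | ⟨h1, h2, h3, h4⟩
      · exact .inl ⟨h1, not_lt.1 fun h' => h ⟨h2, h'⟩, h3⟩
      · exact .inr ⟨h1, h2, not_le.1 fun h' => h ⟨h', h4⟩⟩
    have hnext : ε = 1 ∧ -(c / 2) ≤ X - ε * c ∧ X - ε * c < c / 2 + α ∧ X - ε * c < c / 2 + n * c ∨
        ε = -1 ∧ -(c / 2) - α ≤ X - ε * c ∧ -(c / 2) - n * c ≤ X - ε * c ∧ X - ε * c < c / 2 := by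
      push_cast at hX
      rcases hstep with ⟨rfl, h2, h3⟩ | ⟨rfl, h2, h3⟩
      · refine .inl ⟨rfl, ?_, ?_, ?_⟩ <;> push_cast <;> simp at hX <;> linarith
      · refine .inr ⟨rfl, ?_, ?_, ?_⟩ <;> push_cast <;> simp at hX <;> linarith
    obtain ⟨k, hk, -, hp⟩ := ih hnext
    have e : X - ε * c - ε * (k * c) = X - ε * ((k + 1 : ℕ) * c) := by push_cast; ring
    rw [e] at hk hp
    refine ⟨k + 1, hk, fun _ => by omega, ?_⟩
    have := (passes_bump hα hβ hc hc0 hL hy hstep).trans hp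
    rwa [show 4 * b * (k + 1) = 4 * b + 4 * b * k by ring]

end passage

/-! ### Renormalization: the return map to the core -/

lemma stateSwap_coverState (x y : ℝ) (d : ℤ × ℤ) :
    stateSwap (coverState x y d) = coverState y x d.swap := rfl

lemma squareWave_mul {c u : ℝ} (hc0 : 0 < c) (hc1 : c ≤ 1) (hu : u ∈ Ico (-(1 / 2) : ℝ) (1 / 2)) :
    squareWave (c * u) = squareWave u := by
  obtain ⟨h0, h1⟩ := hu
  rcases le_or_gt 0 u with h | h
  · rw [squareWave_eq_one h h1, squareWave_eq_one (by positivity) (by nlinarith)]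
  · rw [squareWave_eq_neg_one h0 h, squareWave_eq_neg_one (by nlinarith) (by nlinarith)]

lemma mul_mem_Ico_iff {c u : ℝ} (hc : 0 < c) :
    c * u ∈ Ico (-(c / 2)) (c / 2) ↔ u ∈ Ico (-(1 / 2) : ℝ) (1 / 2) := by
  constructor <;> rintro ⟨h0, h1⟩ <;> constructor <;> nlinarith

lemma mem_Nset_iff {d : ℤ × ℤ} :
    d ∈ Nset ↔ (∃ ε : ℤ, (ε = 1 ∨ ε = -1) ∧ d = (ε, 0)) ∨
      ∃ ε : ℤ, (ε = 1 ∨ ε = -1) ∧ d = (0, ε) := by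
  simp only [Nset, mem_insert_iff, mem_singleton_iff]
  constructor
  · rintro (rfl | rfl | rfl | rfl) <;> simp
  · rintro (⟨ε, rfl | rfl, rfl⟩ | ⟨ε, rfl | rfl, rfl⟩) <;> simp

section renormalization

variable {α β c L : ℝ} {b : ℕ}

lemma exists_return_of_horizontal (hα : 0 < α) (hβ : 0 < β) (hc : c = 1 - 2 * b * α) (hc0 : 0 < c)
    (hL : L = 1 - 2 * b * β) {u y : ℝ} (hu : u ∈ Ico (-(1 / 2) : ℝ) (1 / 2))
    (hy : y ∈ Ico (-(L / 2)) (L / 2)) {ε : ℤ} (hε : ε = 1 ∨ ε = -1) :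
    ∃ u' ∈ Ico (-(1 / 2) : ℝ) (1 / 2), ∃ k : ℕ,
      u' = u + ε * (α / c) - ε * k ∧ (c ≤ α → 1 ≤ k) ∧
      Passes (coverMap α β) (core c L) (4 * b * k) (coverState (c * u + ε * α) y (ε, 0))
        (coverState (c * u') y (ε, 0)) := by
  have hcu := (mul_mem_Ico_iff hc0).2 hu
  obtain ⟨n, hn⟩ := exists_nat_gt (α / c)
  rw [div_lt_iff₀ hc0] at hn
  obtain ⟨k, hk, hk1, hp⟩ := exists_passes_core hα hβ hc hc0 hL hy n (X := c * u + ε * α) (ε := ε)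
    (by
      obtain ⟨h0, h1⟩ := hcu
      rcases hε with rfl | rfl
      · refine .inl ⟨rfl, ?_, ?_, ?_⟩ <;> push_cast <;> linarith
      · refine .inr ⟨rfl, ?_, ?_, ?_⟩ <;> push_cast <;> linarith)
  have e : c * u + ε * α - ε * (k * c) = c * (u + ε * (α / c) - ε * k) := by
    field_simp
  rw [e] at hk hp
  refine ⟨_, (mul_mem_Ico_iff hc0).1 hk, k, rfl, fun h => hk1 fun h' => ?_, hp⟩
  obtain ⟨h0, h1⟩ := hcu
  obtain ⟨h2, h3⟩ := h'
  rcases hε with rfl | rfl <;> push_cast at h2 h3 <;> linarith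

/-- The renormalization of `coverMap α β` as a return map to the core. -/
lemma exists_return (hα : 0 < α) (hβ : 0 < β) (hc : c = 1 - 2 * b * α) (hc0 : 0 < c)
    (hL : L = 1 - 2 * b * β) (hL0 : 0 < L) (hLβ : L ≤ β) {u v : ℝ}
    (hu : u ∈ Ico (-(1 / 2) : ℝ) (1 / 2)) (hv : v ∈ Ico (-(1 / 2) : ℝ) (1 / 2)) {d : ℤ × ℤ}
    (hd : d ∈ Nset) :
    ∃ u' ∈ Ico (-(1 / 2) : ℝ) (1 / 2), ∃ v' ∈ Ico (-(1 / 2) : ℝ) (1 / 2), ∃ d' ∈ Nset, ∃ n : ℕ,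
      coverMap (α / c) (β / L) (coverState u v d) = coverState u' v' d' ∧
      Passes (coverMap α β) (core c L) n (coverMap α β (coverState (c * u) (L * v) d))
        (coverState (c * u') (L * v') d') ∧
      (d.1 ≠ 0 → 4 * b ≤ n) := by
  have hc1 : c ≤ 1 := by rw [hc]; nlinarith [show (0 : ℝ) ≤ b * α by positivity]
  have hL1 : L ≤ 1 := by rw [hL]; nlinarith [show (0 : ℝ) ≤ b * β by positivity]
  have hsign {δ : ℤ} (hδ : δ = 1 ∨ δ = -1) :
      δ * (squareWave u * squareWave v) = 1 ∨ δ * (squareWave u * squareWave v) = -1 := by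
    rcases hδ with rfl | rfl <;> rcases squareWave_eq_or u with h | h <;>
      rcases squareWave_eq_or v with h' | h' <;> simp [h, h']
  rcases mem_Nset_iff.1 hd with ⟨δ, hδ, rfl⟩ | ⟨δ, hδ, rfl⟩
  · set ε := δ * (squareWave u * squareWave v) with hεdef
    obtain ⟨v', hv', k, hvk, hk, hp⟩ := exists_return_of_horizontal hβ hα hL hL0 hc hv
      ((mul_mem_Ico_iff hc0).2 hu) (hsign hδ)
    rw [← hεdef] at hvk hp
    refine ⟨u, hu, v', hv', (0, ε), mem_Nset_iff.2 (.inr ⟨ε, hsign hδ, rfl⟩), 4 * b * k, ?_, ?_,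
      fun _ => Nat.le_mul_of_pos_right _ (hk hLβ)⟩
    · rw [coverMap_coverState]
      refine coverState_eq_coverState 0 (ε * k) ?_ ?_ ?_
      · simp
      · rw [← hεdef, hvk]; push_cast; ring
      · simp [hεdef]
    · have h := hp.semiconj (stateSwap_coverMap β α) (B := core c L) fun _ h => And.intro h.2 h.1
      rw [stateSwap_coverState, stateSwap_coverState, Prod.swap_prod_mk] at h
      convert h using 1
      rw [coverMap_coverState, squareWave_mul hc0 hc1 hu, squareWave_mul hL0 hL1 hv, ← hεdef]
      simp
  · set ε := δ * (squareWave u * squareWave v) with hεdef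
    obtain ⟨u', hu', k, huk, -, hp⟩ := exists_return_of_horizontal hα hβ hc hc0 hL hu
      ((mul_mem_Ico_iff hL0).2 hv) (hsign hδ)
    rw [← hεdef] at huk hp
    refine ⟨u', hu', v, hv, (ε, 0), mem_Nset_iff.2 (.inl ⟨ε, hsign hδ, rfl⟩), 4 * b * k, ?_, ?_,
      fun h => absurd rfl h⟩
    · rw [coverMap_coverState]
      refine coverState_eq_coverState (ε * k) 0 ?_ ?_ ?_
      · rw [← hεdef, huk]; push_cast; ring
      · simp
      · simp [hεdef]
    · convert hp using 1
      rw [coverMap_coverState, squareWave_mul hc0 hc1 hu, squareWave_mul hL0 hL1 hv, ← hεdef]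
      simp

/-- A return of `coverMap α β` to the core is an iterate of the renormalized map. -/
lemma exists_iterate_of_iterate (hα : 0 < α) (hβ : 0 < β) (hb : 1 ≤ b) (hc : c = 1 - 2 * b * α)
    (hc0 : 0 < c) (hL : L = 1 - 2 * b * β) (hL0 : 0 < L) (hLβ : L ≤ β) {u' v' : ℝ}
    (hu' : u' ∈ Ico (-(1 / 2) : ℝ) (1 / 2)) (hv' : v' ∈ Ico (-(1 / 2) : ℝ) (1 / 2))
    {d' : ℤ × ℤ} (N : ℕ) {u v : ℝ} (hu : u ∈ Ico (-(1 / 2) : ℝ) (1 / 2))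
    (hv : v ∈ Ico (-(1 / 2) : ℝ) (1 / 2)) {d : ℤ × ℤ} (hd : d ∈ Nset)
    (h : (coverMap α β)^[N] (coverState (c * u) (L * v) d) = coverState (c * u') (L * v') d') :
    ∃ k ≤ N, (1 ≤ N → 1 ≤ k) ∧ (1 ≤ N → d.1 ≠ 0 → k < N) ∧
      (coverMap (α / c) (β / L))^[k] (coverState u v d) = coverState u' v' d' := by
  induction N using Nat.strong_induction_on generalizing u v d with
  | _ N ih =>
  have hc1 : c ≤ 1 := by rw [hc]; nlinarith [show (0 : ℝ) ≤ b * α by positivity]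
  have hL1 : L ≤ 1 := by rw [hL]; nlinarith [show (0 : ℝ) ≤ b * β by positivity]
  have inj {e x x' : ℝ} (he0 : 0 < e) (he1 : e ≤ 1) (hx : x ∈ Ico (-(1 / 2) : ℝ) (1 / 2))
      (hx' : x' ∈ Ico (-(1 / 2) : ℝ) (1 / 2))
      (hxx : ((e * x : ℝ) : UnitAddCircle) = (e * x' : ℝ)) : x = x' := by
    have hm {z : ℝ} (hz : z ∈ Ico (-(1 / 2) : ℝ) (1 / 2)) :
        e * z ∈ Ico (-(1 / 2) : ℝ) (-(1 / 2) + 1) := by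
      obtain ⟨h0, h1⟩ := (mul_mem_Ico_iff he0).2 hz
      constructor <;> linarith
    have := (AddCircle.coe_eq_coe_iff_of_mem_Ico (p := 1) (hm hx) (hm hx')).1 hxx
    exact mul_left_cancel₀ he0.ne' this
  rcases N with _ | N
  · simp only [Function.iterate_zero, id, coverState, Prod.mk.injEq] at h
    obtain ⟨⟨h1, h2⟩, rfl⟩ := h
    obtain rfl := inj hc0 hc1 hu hu' h1
    obtain rfl := inj hL0 hL1 hv hv' h2
    exact ⟨0, le_rfl, by simp, by simp, rfl⟩
  · obtain ⟨u₁, hu₁, v₁, hv₁, d₁, hd₁, n, hT, hp, hn⟩ :=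
      exists_return hα hβ hc hc0 hL hL0 hLβ hu hv hd
    rw [Function.iterate_succ_apply] at h
    have hnN : n ≤ N := by
      by_contra! hlt
      refine hp.2 N hlt ?_
      rw [h]
      exact ⟨⟨_, (mul_mem_Ico_iff hc0).2 hu', rfl⟩, ⟨_, (mul_mem_Ico_iff hL0).2 hv', rfl⟩⟩
    obtain ⟨m, rfl⟩ := Nat.exists_eq_add_of_le hnN
    rw [add_comm n m, Function.iterate_add_apply, hp.1] at h
    obtain ⟨k, hk, -, -, hkT⟩ := ih m (by omega) hu₁ hv₁ hd₁ h
    refine ⟨k + 1, by omega, by omega, fun _ hd1 => ?_, ?_⟩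
    · have := hn hd1
      omega
    · rw [Function.iterate_succ_apply, hT, hkT]

end renormalization

/-! ### Measure of sets in `X × N` -/

lemma prod_mN_apply {X : Type*} [MeasurableSpace X] (ν : Measure X) [SFinite ν]
    {E : Set (X × (ℤ × ℤ))} (hE : MeasurableSet E) :
    (ν.prod mN) E = 4⁻¹ * (ν {x | (x, (1, 0)) ∈ E} + ν {x | (x, (-1, 0)) ∈ E} +
      ν {x | (x, (0, 1)) ∈ E} + ν {x | (x, (0, -1)) ∈ E}) := by
  have : SFinite mN := by unfold mN; infer_instance
  rw [Measure.prod_apply_symm hE]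
  simp [mN, lintegral_add_measure, lintegral_smul_measure, preimage, mul_add]

instance : IsProbabilityMeasure mN := ⟨by
  simp only [mN, Measure.smul_apply, Measure.add_apply, measure_univ, smul_eq_mul]
  rw [show (1 : ℝ≥0∞) + 1 + 1 + 1 = 4 by norm_num]
  exact ENNReal.inv_mul_cancel (by norm_num) (by norm_num)⟩

lemma map_mN (f : ℤ × ℤ → ℤ × ℤ) :
    mN.map f = (4 : ℝ≥0∞)⁻¹ • (Measure.dirac (f (1, 0)) + Measure.dirac (f (-1, 0)) +
      Measure.dirac (f (0, 1)) + Measure.dirac (f (0, -1))) := by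
  have hf : Measurable f := measurable_of_countable f
  simp only [mN, Measure.map_smul, Measure.map_add _ _ hf, Measure.map_dirac' hf]

lemma map_turn_mN {s : ℤ} (hs : s = 1 ∨ s = -1) :
    mN.map (fun d : ℤ × ℤ => (d.2 * s, d.1 * s)) = mN := by
  rw [map_mN, mN]
  congr 1
  rcases hs with rfl | rfl <;> norm_num <;> abel

lemma map_swap_mN : mN.map Prod.swap = mN := by
  rw [map_mN, mN]
  congr 1
  simp only [Prod.swap_prod_mk]
  abel

instance : IsProbabilityMeasure (volume : Measure UnitAddCircle) := ⟨UnitAddCircle.measure_univ⟩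

/-- The uniform probability measure on `(ℝ/ℤ)² × N`. -/
noncomputable def coverMeas : Measure CoverState :=
  ((volume : Measure UnitAddCircle).prod volume).prod mN

instance : IsProbabilityMeasure coverMeas := by unfold coverMeas; infer_instance

lemma measurePreserving_coverMap (α β : ℝ) :
    MeasurePreserving (coverMap α β) coverMeas coverMeas := by
  set ν : Measure (UnitAddCircle × UnitAddCircle) := volume.prod volume
  have hturn : MeasurePreserving (fun p : CoverState => (id p.1,
      (p.2.2 * (circleWave p.1.1 * circleWave p.1.2),
        p.2.1 * (circleWave p.1.1 * circleWave p.1.2)))) (ν.prod mN) (ν.prod mN) := by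
    refine (MeasurePreserving.id ν).skew_product
      (g := fun x (d : ℤ × ℤ) => (d.2 * (circleWave x.1 * circleWave x.2),
        d.1 * (circleWave x.1 * circleWave x.2))) ?_ (.of_forall fun x => map_turn_mN ?_)
    · have := measurable_circleWave
      unfold Function.uncurry
      fun_prop
    · rcases circleWave_eq_or x.1 with h | h <;> rcases circleWave_eq_or x.2 with h' | h' <;>
        simp [h, h']
  have hmove : MeasurePreserving (fun p : (ℤ × ℤ) × (UnitAddCircle × UnitAddCircle) =>
      (id p.1, (p.2.1 + ((p.1.1 * α : ℝ) : UnitAddCircle),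
        p.2.2 + ((p.1.2 * β : ℝ) : UnitAddCircle)))) (mN.prod ν) (mN.prod ν) := by
    refine (MeasurePreserving.id mN).skew_product
      (g := fun d (x : UnitAddCircle × UnitAddCircle) => (x.1 + ((d.1 * α : ℝ) : UnitAddCircle),
        x.2 + ((d.2 * β : ℝ) : UnitAddCircle))) ?_ (.of_forall fun d => ?_)
    · exact measurable_from_prod_countable_right fun d => by unfold Function.uncurry; fun_prop
    · exact ((measurePreserving_add_right volume ((d.1 * α : ℝ) : UnitAddCircle)).prod
        (measurePreserving_add_right volume ((d.2 * β : ℝ) : UnitAddCircle))).map_eq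
  have hswap : MeasurePreserving Prod.swap (ν.prod mN) (mN.prod ν) :=
    ⟨measurable_swap, Measure.prod_swap⟩
  have hswap' : MeasurePreserving Prod.swap (mN.prod ν) (ν.prod mN) :=
    ⟨measurable_swap, Measure.prod_swap⟩
  exact hswap'.comp (hmove.comp (hswap.comp hturn))

lemma measurePreserving_stateSwap : MeasurePreserving stateSwap coverMeas coverMeas := by
  exact MeasurePreserving.prod ⟨measurable_swap, Measure.prod_swap⟩ ⟨measurable_swap, map_swap_mN⟩

/-! ### Periodic points -/

/-- The points of period at most `t`. -/
def periodicUpTo {X : Type*} (T : X → X) (t : ℕ) : Set X := {x | ∃ n, 1 ≤ n ∧ n ≤ t ∧ T^[n] x = x}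

lemma periodicUpTo_mono {X : Type*} (T : X → X) : Monotone (periodicUpTo T) :=
  fun _ _ h _ ⟨n, h1, h2, h3⟩ => ⟨n, h1, h2.trans h, h3⟩

lemma measurableSet_periodicUpTo {X : Type*} [MeasurableSpace X] [MeasurableEq X] {T : X → X}
    (hT : Measurable T) (t : ℕ) : MeasurableSet (periodicUpTo T t) := by
  have : periodicUpTo T t = ⋃ n ∈ {n | 1 ≤ n ∧ n ≤ t}, {x | T^[n] x = x} := by
    ext x; simp [periodicUpTo, and_assoc]
  rw [this]
  exact MeasurableSet.biUnion (to_countable _) fun n _ =>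
    measurableSet_eq_fun (hT.iterate n) measurable_id

lemma iterate_mem_periodicUpTo {X : Type*} {T : X → X} {t : ℕ} {x : X} (hx : x ∈ periodicUpTo T t)
    (j : ℕ) : T^[j] x ∈ periodicUpTo T t := by
  obtain ⟨n, h1, h2, h3⟩ := hx
  refine ⟨n, h1, h2, ?_⟩
  rw [← Function.iterate_add_apply, add_comm, Function.iterate_add_apply, h3]

/-- Points that do not return to `A` for a long time force the periodic points to be few. -/
lemma measure_periodicUpTo_add_le {X : Type*} [MeasurableSpace X] [MeasurableEq X] {μ : Measure X}
    [IsProbabilityMeasure μ] {T : X → X} (hT : MeasurePreserving T μ μ) (t : ℕ) {A : Set X}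
    (hA : MeasurableSet A) (hAt : Disjoint A (periodicUpTo T t)) {m : ℕ}
    (hret : ∀ x ∈ A, ∀ j, 1 ≤ j → j < m → T^[j] x ∉ A) :
    μ (periodicUpTo T t) + m * μ A ≤ 1 := by
  have hmeas (j : ℕ) : MeasurableSet (T^[j] ⁻¹' A) := (hT.iterate j).measurable hA
  have hdisj : ((Finset.range m : Finset ℕ) : Set ℕ).PairwiseDisjoint fun j => T^[j] ⁻¹' A := by
    have key {i j : ℕ} (hij : i < j) (hj : j < m) : Disjoint (T^[i] ⁻¹' A) (T^[j] ⁻¹' A) := by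
      refine disjoint_left.2 fun x hi hx => hret _ hi (j - i) (by omega) (by omega) ?_
      rw [← Function.iterate_add_apply, Nat.sub_add_cancel hij.le]
      exact hx
    intro i hi j hj hij
    simp only [Finset.coe_range, mem_Iio] at hi hj
    rcases lt_or_gt_of_ne hij with h | h
    · exact key h hj
    · exact (key h hi).symm
  have hsum : μ (⋃ j ∈ Finset.range m, T^[j] ⁻¹' A) = m * μ A := by
    rw [measure_biUnion_finset hdisj fun j _ => hmeas j]
    simp [(hT.iterate _).measure_preimage hA.nullMeasurableSet]
  rw [← hsum, ← measure_union _ (Finset.measurableSet_biUnion _ fun j _ => hmeas j)]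
  · exact prob_le_one
  · refine disjoint_left.2 fun x hx hx' => ?_
    obtain ⟨j, -, hj⟩ := mem_iUnion₂.1 hx'
    exact disjoint_left.1 hAt hj (iterate_mem_periodicUpTo hx j)

lemma coverMeas_periodicUpTo_swap (α β : ℝ) (t : ℕ) :
    coverMeas (periodicUpTo (coverMap α β) t) = coverMeas (periodicUpTo (coverMap β α) t) := by
  rw [← measurePreserving_stateSwap.measure_preimage
    (measurableSet_periodicUpTo (measurePreserving_coverMap β α).measurable t).nullMeasurableSet]
  congr 1
  have hinj : Function.Injective stateSwap := fun p q h => by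
    simpa [stateSwap, Prod.ext_iff, and_comm] using h
  ext p
  simp only [periodicUpTo, mem_preimage, mem_ofPred_eq]
  refine exists_congr fun n => and_congr_right fun _ => and_congr_right fun _ => ?_
  rw [← ((stateSwap_coverMap α β).iterate_right n) p, hinj.eq_iff]

lemma coverMap_add_one (α β : ℝ) : coverMap α (β + 1) = coverMap α β := by
  funext p
  have h (k : ℤ) : (((k : ℝ) * (β + 1) : ℝ) : UnitAddCircle) = ((k * β : ℝ) : UnitAddCircle) := by
    rw [mul_add, mul_one, AddCircle.coe_add]
    simp
  simp only [coverMap, h]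

/-! ### The renormalization inequality -/

/-- The covering `ℝ² → (ℝ/ℤ)²`. -/
def planeCover (p : ℝ × ℝ) : UnitAddCircle × UnitAddCircle := (p.1, p.2)

lemma measurable_planeCover : Measurable planeCover :=
  (AddCircle.measurable_mk'.comp measurable_fst).prodMk (AddCircle.measurable_mk'.comp measurable_snd)

lemma measurePreserving_planeCover (t : ℝ) :
    MeasurePreserving planeCover (volume.restrict (Ico t (t + 1) ×ˢ Ico t (t + 1)))
      (volume.prod volume) := by
  have h : MeasurePreserving (fun x : ℝ => (x : UnitAddCircle)) (volume.restrict (Ico t (t + 1)))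
      volume := by
    rw [Measure.restrict_congr_set (Ico_ae_eq_Ioc (a := t) (b := t + 1))]
    exact UnitAddCircle.measurePreserving_mk t
  rw [Measure.volume_eq_prod, ← Measure.prod_restrict]
  exact h.prod h

lemma volume_preimage_scale {c L : ℝ} (hc : 0 < c) (hL : 0 < L) {S : Set (ℝ × ℝ)}
    (hS : MeasurableSet S) :
    ENNReal.ofReal (c * L) * volume (Prod.map (c * ·) (L * ·) ⁻¹' S) = volume S := by
  have hm : Measurable (Prod.map (c * ·) (L * ·) : ℝ × ℝ → ℝ × ℝ) := by fun_prop
  rw [← Measure.map_apply hm hS, Measure.volume_eq_prod,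
    ← Measure.map_prod_map _ _ (measurable_const_mul c) (measurable_const_mul L),
    Real.map_volume_mul_left hc.ne', Real.map_volume_mul_left hL.ne', Measure.prod_smul_left,
    Measure.prod_smul_right, smul_smul, Measure.smul_apply, smul_eq_mul, ← mul_assoc,
    abs_of_pos (inv_pos.2 hc), abs_of_pos (inv_pos.2 hL),
    ← ENNReal.ofReal_mul (inv_pos.2 hc).le, ← ENNReal.ofReal_mul (by positivity)]
  rw [show c * L * (c⁻¹ * L⁻¹) = 1 by field_simp]
  simp

/-- If every point of the unit torus lies in `F` or is scaled into `G`, then `G` is large. -/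
lemma scale_le_measure_add {c L : ℝ} (hc : 0 < c) (hc1 : c ≤ 1) (hL : 0 < L) (hL1 : L ≤ 1)
    {F G : Set (UnitAddCircle × UnitAddCircle)} (hF : MeasurableSet F) (hG : MeasurableSet G)
    (h : ∀ u ∈ Ico (-(1 / 2) : ℝ) (1 / 2), ∀ v ∈ Ico (-(1 / 2) : ℝ) (1 / 2),
      planeCover (c * u, L * v) ∈ G ∨ planeCover (u, v) ∈ F) :
    ENNReal.ofReal (c * L) ≤
      (volume.prod volume) G + ENNReal.ofReal (c * L) * (volume.prod volume) F := by
  set I := Ico (-(1 / 2) : ℝ) (-(1 / 2) + 1)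
  have hI : I = Ico (-(1 / 2) : ℝ) (1 / 2) := by simp only [I]; norm_num
  have hP := measurePreserving_planeCover (-(1 / 2))
  have hvol {E : Set (UnitAddCircle × UnitAddCircle)} (hE : MeasurableSet E) :
      (volume.prod volume) E = volume (planeCover ⁻¹' E ∩ I ×ˢ I) := by
    rw [← hP.measure_preimage hE.nullMeasurableSet,
      Measure.restrict_apply (measurable_planeCover hE)]
  have hQ : volume (I ×ˢ I) = 1 := by
    rw [Measure.volume_eq_prod, Measure.prod_prod]
    simp [I]
  have hscale {e x : ℝ} (he : 0 < e) (he1 : e ≤ 1) (hx : x ∈ I) : e * x ∈ I := by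
    rw [hI] at hx ⊢
    obtain ⟨h0, h1⟩ := (mul_mem_Ico_iff he).2 hx
    constructor <;> linarith
  rw [hvol hF, hvol hG, ← volume_preimage_scale hc hL
    ((measurable_planeCover hG).inter (measurableSet_Ico.prod measurableSet_Ico)), ← mul_add]
  refine le_mul_of_one_le_right' ?_
  rw [← hQ]
  refine (measure_mono fun p hp => ?_).trans (measure_union_le _ _)
  rcases h p.1 (hI ▸ hp.1) p.2 (hI ▸ hp.2) with h' | h'
  · exact .inl ⟨h', hscale hc hc1 hp.1, hscale hL hL1 hp.2⟩
  · exact .inr ⟨h', hp⟩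

lemma measurableSet_arc (c : ℝ) : MeasurableSet (arc c) := by
  have h : (fun x : ℝ => (x : UnitAddCircle)) ⁻¹' arc c =
      ⋃ k : ℤ, (fun x : ℝ => x + k) ⁻¹' Ico (-(c / 2)) (c / 2) := by
    ext x
    simp only [arc, mem_preimage, mem_image, mem_iUnion]
    constructor
    · rintro ⟨y, hy, hxy⟩
      obtain ⟨m, hm⟩ := (AddCircle.coe_eq_zero_iff (1 : ℝ)).1
        (show ((y - x : ℝ) : UnitAddCircle) = 0 by simpa [sub_eq_zero] using hxy)
      refine ⟨m, ?_⟩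
      rwa [show x + m = y by simp at hm; linarith]
    · rintro ⟨k, hk⟩
      exact ⟨x + k, hk, by simp⟩
  have h' : MeasurableSet ((fun x : ℝ => (x : UnitAddCircle)) ⁻¹' arc c) := by
    rw [h]
    exact .iUnion fun k => measurable_add_const _ measurableSet_Ico
  exact h'

lemma measurableSet_core (c L : ℝ) : MeasurableSet (core c L) :=
  ((measurable_fst.comp measurable_fst) (measurableSet_arc c)).inter
    ((measurable_snd.comp measurable_fst) (measurableSet_arc L))

/-- Few periodic points for the renormalized parameters give few periodic points. -/
lemma coverMeas_periodicUpTo_le {α β c L : ℝ} {b : ℕ} (hα : 0 < α) (hβ : 0 < β) (hb : 1 ≤ b)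
    (hc : c = 1 - 2 * b * α) (hc0 : 0 < c) (hL : L = 1 - 2 * b * β) (hL0 : 0 < L) (hLβ : L ≤ β)
    (t : ℕ) :
    coverMeas.real (periodicUpTo (coverMap α β) (t + 1)) ≤
      1 - 2 * b * c * L + 2 * coverMeas.real (periodicUpTo (coverMap (α / c) (β / L)) t) := by
  have hc1 : c ≤ 1 := by rw [hc]; nlinarith [show (0 : ℝ) ≤ b * α by positivity]
  have hL1 : L ≤ 1 := by rw [hL]; nlinarith [show (0 : ℝ) ≤ b * β by positivity]
  set P := periodicUpTo (coverMap α β) (t + 1)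
  set P' := periodicUpTo (coverMap (α / c) (β / L)) t
  have hP : MeasurableSet P :=
    measurableSet_periodicUpTo (measurePreserving_coverMap α β).measurable _
  have hP' : MeasurableSet P' :=
    measurableSet_periodicUpTo (measurePreserving_coverMap (α / c) (β / L)).measurable _
  set A : Set CoverState := core c L ∩ Prod.snd ⁻¹' {d | d ∈ Nset ∧ d.1 ≠ 0} ∩ Pᶜ
  have hA : MeasurableSet A :=
    ((measurableSet_core c L).inter (measurable_snd (to_countable _).measurableSet)).inter
      hP.compl
  have hret : ∀ s ∈ A, ∀ j, 1 ≤ j → j < 4 * b → (coverMap α β)^[j] s ∉ A := by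
    rintro ⟨⟨x, y⟩, d⟩ ⟨⟨⟨⟨x, hx, rfl⟩, ⟨y, hy, rfl⟩⟩, hd, hd1⟩, -⟩ j hj1 hj hjA
    obtain ⟨u, rfl⟩ : ∃ u, x = c * u := ⟨x / c, by field_simp⟩
    obtain ⟨v, rfl⟩ : ∃ v, y = L * v := ⟨y / L, by field_simp⟩
    obtain ⟨u', -, v', -, d', -, n, -, hp, hn⟩ := exists_return hα hβ hc hc0 hL hL0 hLβ
      ((mul_mem_Ico_iff hc0).1 hx) ((mul_mem_Ico_iff hL0).1 hy) hd
    obtain ⟨i, rfl⟩ := Nat.exists_eq_add_of_le' hj1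
    rw [Function.iterate_succ_apply] at hjA
    exact hp.2 i (by have := hn hd1; omega) hjA.1.1
  have hkac := measure_periodicUpTo_add_le (measurePreserving_coverMap α β) (t + 1) hA
    (disjoint_left.2 fun s hs => hs.2) hret
  have hlow : ENNReal.ofReal (c * L) * 2⁻¹ ≤ coverMeas A + ENNReal.ofReal (c * L) * coverMeas P' := by
    have key {δ : ℤ} (hδ : δ = 1 ∨ δ = -1) := scale_le_measure_add hc0 hc1 hL0 hL1
      (F := {x | (x, (δ, 0)) ∈ P'}) (G := {x | (x, (δ, 0)) ∈ A})
      (measurable_prodMk_right hP') (measurable_prodMk_right hA)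
      (fun u hu v hv => by
        by_cases hPs : coverState (c * u) (L * v) (δ, 0) ∈ P
        · right
          obtain ⟨n, hn1, hn2, hn⟩ := hPs
          obtain ⟨k, -, hk1, hk2, hk⟩ := exists_iterate_of_iterate hα hβ hb hc hc0 hL hL0 hLβ hu hv n
            hu hv (mem_Nset_iff.2 (.inl ⟨δ, hδ, rfl⟩)) hn
          have := hk2 hn1 (by rcases hδ with rfl | rfl <;> simp)
          exact ⟨k, hk1 hn1, by omega, hk⟩
        · left
          exact ⟨⟨⟨⟨_, (mul_mem_Ico_iff hc0).2 hu, rfl⟩, ⟨_, (mul_mem_Ico_iff hL0).2 hv, rfl⟩⟩,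
            mem_Nset_iff.2 (.inl ⟨δ, hδ, rfl⟩), by rcases hδ with rfl | rfl <;> simp⟩, hPs⟩)
    unfold coverMeas
    rw [prod_mN_apply _ hA, prod_mN_apply _ hP']
    have h1 := key (.inl rfl)
    have h2 := key (.inr rfl)
    set r := ENNReal.ofReal (c * L)
    calc r * 2⁻¹ = 4⁻¹ * (r + r) := by
          rw [← two_mul, ← mul_assoc, mul_comm r, show (4 : ℝ≥0∞) = 2 * 2 by norm_num,
            ENNReal.mul_inv (by simp) (by simp), mul_assoc 2⁻¹,
            ENNReal.inv_mul_cancel (by simp) (by simp), mul_one]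
      _ ≤ 4⁻¹ * _ := mul_le_mul_right (add_le_add h1 h2) _
      _ ≤ 4⁻¹ * _ + r * (4⁻¹ * _) := by
          rw [mul_left_comm r, ← mul_add, add_add_add_comm, ← mul_add]
          exact mul_le_mul_right (add_le_add
            (le_self_add.trans le_self_add) (mul_le_mul_right (le_self_add.trans le_self_add) _)) _
  have h2 : (coverMeas P).toReal + 4 * b * (coverMeas A).toReal ≤ 1 := by
    have := ENNReal.toReal_mono ENNReal.one_ne_top hkac
    rw [ENNReal.toReal_add (by finiteness) (by finiteness), ENNReal.toReal_mul] at this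
    simpa using this
  have h3 : c * L / 2 ≤ (coverMeas A).toReal + c * L * (coverMeas P').toReal := by
    have := ENNReal.toReal_mono (by finiteness) hlow
    rw [ENNReal.toReal_add (by finiteness) (by finiteness), ENNReal.toReal_mul, ENNReal.toReal_mul,
      ENNReal.toReal_ofReal (by positivity)] at this
    simpa [div_eq_mul_inv] using this
  have h4 : 4 * b * (c * L) ≤ 2 := by
    have : 4 * b * L ≤ 2 := by nlinarith [show (1 : ℝ) ≤ b by exact_mod_cast hb]
    nlinarith [show 0 ≤ 4 * b * L by positivity]
  simp only [Measure.real]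
  nlinarith [show 0 ≤ (coverMeas P').toReal by positivity]

/-! ### The parameters -/

/-- The inverse branch of the renormalization of a parameter: `1 / (2B + 1 / (1 + x))`. -/
noncomputable def branch (B : ℕ) (x : ℝ) : ℝ := (1 + x) / (2 * B * (1 + x) + 1)

section branch

variable {B : ℕ} {x : ℝ}

lemma branch_pos (hx : 0 ≤ x) : 0 < branch B x := by unfold branch; positivity

lemma branch_lt (hB : 1 ≤ B) (hx : 0 ≤ x) : branch B x < 1 / (2 * B) := by
  have : (1 : ℝ) ≤ B := by exact_mod_cast hB
  unfold branch
  rw [div_lt_div_iff₀ (by positivity) (by positivity)]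
  linarith

lemma branch_lt_half (hB : 1 ≤ B) (hx : 0 ≤ x) : branch B x < 1 / 2 := by
  have : (1 : ℝ) ≤ B := by exact_mod_cast hB
  refine (branch_lt hB hx).trans_le (one_div_le_one_div_of_le (by norm_num) (by linarith))

lemma branch_mono {x' : ℝ} (hx : 0 ≤ x) (h : x ≤ x') : branch B x ≤ branch B x' := by
  unfold branch
  rw [div_le_div_iff₀ (by have : 0 ≤ x' := hx.trans h
                          positivity) (by have : 0 ≤ x' := hx.trans h
                                          positivity)]
  linarith

lemma continuousAt_branch (hx : 0 ≤ x) : ContinuousAt (branch B) x := by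
  unfold branch
  exact ContinuousAt.div (by fun_prop) (by fun_prop) (by positivity)

lemma irrational_branch (hx : 0 ≤ x) (h : Irrational x) : Irrational (branch B x) := by
  rintro ⟨r, hr⟩
  refine h ⟨r / (1 - 2 * B * r) - 1, ?_⟩
  have hL : 1 - 2 * B * branch B x = 1 / (2 * B * (1 + x) + 1) := by
    unfold branch
    field_simp
    ring
  push_cast
  rw [hr, hL]
  unfold branch
  field_simp
  ring

end branch

/-- The approximations to a solution of `p i = branch (B i) (p (i + 2))`. -/
noncomputable def approx (B : ℕ → ℕ) : ℕ → ℕ → ℝ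
  | 0, _ => 0
  | n + 1, i => branch (B i) (approx B n (i + 2))

lemma exists_branch_orbit {B : ℕ → ℕ} (hB : ∀ i, 1 ≤ B i) :
    ∃ p : ℕ → ℝ, ∀ i, 0 < p i ∧ p i = branch (B i) (p (i + 2)) := by
  have h0 (n : ℕ) : ∀ i, 0 ≤ approx B n i := by
    induction n with
    | zero => exact fun _ => le_rfl
    | succ n ih => exact fun i => (branch_pos (ih _)).le
  have hle (n i : ℕ) : approx B n i ≤ 1 / 2 := by
    cases n with
    | zero => norm_num [approx]
    | succ n => exact (branch_lt_half (hB i) (h0 n _)).le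
  have hmono (n : ℕ) : ∀ i, approx B n i ≤ approx B (n + 1) i := by
    induction n with
    | zero => exact fun i => h0 1 i
    | succ n ih => exact fun i => branch_mono (h0 n _) (ih _)
  have hlim (i : ℕ) : Filter.Tendsto (fun n => approx B n i) Filter.atTop
      (nhds (⨆ n, approx B n i)) :=
    tendsto_atTop_ciSup (monotone_nat_of_le_succ fun n => hmono n i)
      ⟨1 / 2, by rintro _ ⟨n, rfl⟩; exact hle n i⟩
  have hsup (i : ℕ) : 0 ≤ ⨆ n, approx B n i := Real.iSup_nonneg fun n => h0 n i
  have hrec (i : ℕ) : ⨆ n, approx B n i = branch (B i) (⨆ n, approx B n (i + 2)) :=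
    tendsto_nhds_unique ((Filter.tendsto_add_atTop_iff_nat 1).2 (hlim i))
      ((continuousAt_branch (hsup (i + 2))).tendsto.comp (hlim (i + 2)))
  refine ⟨fun i => ⨆ n, approx B n i, fun i => ⟨?_, hrec i⟩⟩
  exact (branch_pos (hsup _)).trans_eq (hrec i).symm

lemma irrational_of_branch_orbit {B : ℕ → ℕ} (hB : ∀ i, 1 ≤ B i) {p : ℕ → ℝ}
    (hp : ∀ i, 0 < p i ∧ p i = branch (B i) (p (i + 2))) (i : ℕ) : Irrational (p i) := by
  have key (n : ℕ) : 0 < n → ∀ i, ∀ a : ℤ, p i * n ≠ a := by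
    induction n using Nat.strong_induction_on with
    | _ n ih =>
    intro hn i a ha
    have hn' : (0 : ℝ) < n := by exact_mod_cast hn
    have hx := (hp (i + 2)).1
    have ha0 : (0 : ℝ) < a := ha ▸ mul_pos (hp i).1 hn'
    have hB' : (1 : ℝ) ≤ B i := by exact_mod_cast hB i
    have hy : (1 + p (i + 2)) * (n - 2 * B i * a) = a := by
      rw [← ha]
      conv_lhs => rw [(hp i).2]
      conv_rhs => rw [(hp i).2]
      unfold branch
      field_simp
      ring
    have hm : (0 : ℝ) < n - 2 * B i * a :=
      pos_of_mul_pos_right (hy ▸ ha0) (by positivity)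
    have hm' : (0 : ℤ) < n - 2 * B i * a := by exact_mod_cast hm
    have ha1 : 0 < a := by exact_mod_cast ha0
    obtain ⟨m, hmn⟩ := Int.eq_ofNat_of_zero_le hm'.le
    have hmr : (m : ℝ) = n - 2 * B i * a := by
      have := congrArg (Int.cast (R := ℝ)) hmn
      push_cast at this
      exact this.symm
    have hlt : m < n := by
      have : (0 : ℤ) < 2 * B i * a := by have := hB i; positivity
      omega
    refine ih m hlt (by omega) (i + 2) (a - m) ?_
    push_cast
    rw [← hmr] at hy
    linarith
  rintro ⟨r, hr⟩
  refine key r.den r.pos i r.num ?_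
  rw [← hr]
  exact_mod_cast Rat.mul_den_eq_num r

/-- The bump widths used at the successive renormalization stages. -/
def width (N : ℕ) : ℕ → ℕ
  | 0 => N
  | i + 1 => N * 4 ^ (i + 1) * width N i

lemma le_width {N : ℕ} (hN : 1 ≤ N) (i : ℕ) : N * 4 ^ i ≤ width N i := by
  induction i with
  | zero => simp [width]
  | succ i ih =>
    exact Nat.le_mul_of_pos_right _ (lt_of_lt_of_le (by positivity) ih)

lemma one_le_width {N : ℕ} (hN : 1 ≤ N) (i : ℕ) : 1 ≤ width N i :=
  le_trans (Nat.mul_pos hN (by positivity)) (le_width hN i)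

section stages

variable {N : ℕ} {p : ℕ → ℝ}

/-- One renormalization stage. -/
lemma coverMeas_stage_le (hN : 1 ≤ N)
    (hp : ∀ i, 0 < p i ∧ p i = branch (width N i + width N (i + 1)) (p (i + 2))) (i t : ℕ) :
    coverMeas.real (periodicUpTo (coverMap (p i) (branch (width N i) (p (i + 1)))) (t + 1)) ≤
      2 / (N * 4 ^ i) + 2 * coverMeas.real (periodicUpTo
        (coverMap (p (i + 1)) (branch (width N (i + 1)) (p (i + 2)))) t) := by
  have hx := (hp (i + 1)).1
  have hy := (hp (i + 2)).1
  have hbw := le_width hN i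
  have hb := one_le_width hN i
  have hb' := one_le_width hN (i + 1)
  have hbb : width N (i + 1) = N * 4 ^ (i + 1) * width N i := rfl
  have hpi := (hp i).2
  have hx1 : p (i + 1) < 1 / (2 * width N i) := by
    have hle : width N i ≤ width N (i + 1) := by
      rw [hbb]
      exact Nat.le_mul_of_pos_left _ (by positivity)
    rw [(hp (i + 1)).2]
    refine (branch_lt (by omega) (hp (i + 3)).1.le).trans_le ?_
    gcongr
    exact_mod_cast hle.trans (Nat.le_add_right _ _)
  have hpi1 : 2 * width N i * p i ≤ 1 / (N * 4 ^ i) := by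
    have hlt := branch_lt (B := width N i + width N (i + 1)) (by omega) hy.le
    have hb0 : (0 : ℝ) < width N i := by exact_mod_cast hb
    rw [← hpi] at hlt
    calc 2 * width N i * p i ≤ 2 * width N i * (1 / (2 * (width N i + width N (i + 1) : ℕ))) := by
          gcongr
      _ ≤ 1 / (N * 4 ^ i) := by
        rw [hbb]
        push_cast
        rw [mul_one_div, div_le_div_iff₀ (by positivity) (by positivity)]
        have : (0 : ℝ) ≤ N * 4 ^ i * width N i := by positivity
        rw [pow_succ]
        linarith
  set b := width N i
  set b' := width N (i + 1)
  have hbR : (1 : ℝ) ≤ b := by exact_mod_cast hb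
  have hbR' : (1 : ℝ) ≤ b' := by exact_mod_cast hb'
  set x := p (i + 1)
  set y := p (i + 2)
  have hc : 1 - 2 * b * p i = (2 * b' * (1 + y) + 1) / (2 * (b + b') * (1 + y) + 1) := by
    rw [hpi, branch]
    push_cast
    field_simp
    ring
  have hL : 1 - 2 * b * branch b x = 1 / (2 * b * (1 + x) + 1) := by
    unfold branch
    field_simp
    ring
  have hdc : p i / (1 - 2 * b * p i) = branch b' y := by
    rw [hc, hpi, branch, branch]
    push_cast
    field_simp
  have hdL : branch b x / (1 - 2 * b * branch b x) = x + 1 := by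
    rw [hL, branch]
    field_simp
    ring
  have hLβ : 1 - 2 * b * branch b x ≤ branch b x := by
    rw [hL, branch]
    gcongr
    linarith
  have h := coverMeas_periodicUpTo_le (hp i).1 (branch_pos hx.le) hb rfl (by rw [hc]; positivity)
    rfl (by rw [hL]; positivity) hLβ t
  rw [hdc, hdL, coverMap_add_one, Measure.real, Measure.real, coverMeas_periodicUpTo_swap _ x,
    ← Measure.real, ← Measure.real] at h
  refine h.trans (add_le_add_left ?_ _)
  have hD : 0 < (N : ℝ) * 4 ^ i := by positivity
  have hbD : (N : ℝ) * 4 ^ i ≤ b := by exact_mod_cast hbw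
  rw [lt_div_iff₀ (by positivity)] at hx1
  have hL2 : 1 - 2 * b * (1 - 2 * b * branch b x) ≤ 1 / (N * 4 ^ i) := by
    rw [hL]
    calc 1 - 2 * b * (1 / (2 * b * (1 + x) + 1)) = (2 * b * x + 1) / (2 * b * (1 + x) + 1) := by
          field_simp
          ring
      _ ≤ 2 / (2 * b) := div_le_div₀ zero_le_two (by linarith) (by positivity) (by nlinarith)
      _ = 1 / b := by field_simp
      _ ≤ 1 / (N * 4 ^ i) := one_div_le_one_div_of_le hD hbD
  have hL3 : 2 * b * (1 - 2 * b * branch b x) ≤ 1 := by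
    rw [hL, mul_one_div, div_le_one (by positivity)]
    nlinarith
  rw [← one_add_one_eq_two, add_div, one_add_one_eq_two]
  nlinarith [mul_nonneg (show 0 ≤ 2 * b * p i by have := (hp i).1; positivity) (sub_nonneg.2 hL3)]

lemma coverMeas_stages_le (hN : 1 ≤ N)
    (hp : ∀ i, 0 < p i ∧ p i = branch (width N i + width N (i + 1)) (p (i + 2))) (t : ℕ) :
    ∀ i, coverMeas.real (periodicUpTo (coverMap (p i) (branch (width N i) (p (i + 1)))) t) ≤
      4 / (N * 4 ^ i) := by
  induction t with
  | zero =>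
    intro i
    have : periodicUpTo (coverMap (p i) (branch (width N i) (p (i + 1)))) 0 = ∅ := by
      refine eq_empty_of_forall_notMem fun s ⟨n, h1, h0, _⟩ => ?_
      omega
    rw [this, measureReal_empty]
    positivity
  | succ t ih =>
    intro i
    have hN' : (1 : ℝ) ≤ N := by exact_mod_cast hN
    refine (coverMeas_stage_le hN hp i t).trans ((add_le_add_right
      (mul_le_mul_of_nonneg_left (ih (i + 1)) zero_le_two) _).trans_eq ?_)
    field_simp
    ring

end stages

lemma exists_irrational_coverMeas_le {N : ℕ} (hN : 1 ≤ N) :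
    ∃ α ∈ Icc (0 : ℝ) (1 / 2), ∃ β ∈ Icc (0 : ℝ) (1 / 2), Irrational α ∧ Irrational β ∧
      ∀ t, coverMeas.real (periodicUpTo (coverMap α β) t) ≤ 4 / N := by
  have hB (i : ℕ) : 1 ≤ width N i + width N (i + 1) :=
    (one_le_width hN i).trans (Nat.le_add_right _ _)
  obtain ⟨p, hp⟩ := exists_branch_orbit hB
  have hirr := irrational_of_branch_orbit hB hp
  have hp0 := (hp 0).1
  have hp1 := (hp 1).1.le
  refine ⟨p 0, ⟨hp0.le, ?_⟩, branch (width N 0) (p 1),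
    ⟨(branch_pos hp1).le, (branch_lt_half (one_le_width hN 0) hp1).le⟩, hirr 0,
    irrational_branch hp1 (hirr 1), fun t => by simpa using coverMeas_stages_le hN hp t 0⟩
  rw [(hp 0).2]
  exact (branch_lt_half (hB 0) (hp 2).1.le).le

/-! ### Comparison of `Ψ` with its lift -/

/-- The sign of a point of the plane. -/
noncomputable def planeSign (p : ℝ × ℝ) : ℤ := squareWave p.1 * squareWave p.2

lemma planeSign_add_of_mem {v : ℝ × ℝ} (hv : v ∈ Lam) (p : ℝ × ℝ) :
    planeSign (p + v) = planeSign p := by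
  have hneg (x : ℝ) : squareWave (x + -(1 / 2)) = -squareWave x := by
    rw [← neg_inj, ← squareWave_add_half, neg_neg, neg_add_cancel_right]
  unfold Lam at hv
  induction hv using AddSubgroup.closure_induction generalizing p with
  | mem v hv =>
    rcases hv with rfl | rfl
    · simp only [planeSign, Prod.fst_add, Prod.snd_add, squareWave_add_half, neg_mul_neg]
    · simp only [planeSign, Prod.fst_add, Prod.snd_add, squareWave_add_half, hneg, neg_mul_neg]
  | zero => rw [add_zero]
  | add v w _ _ hv hw => rw [← add_assoc, hw, hv]
  | neg v _ hv => rw [← hv, neg_add_cancel_right]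

lemma squareWave_eq_ite_fract (y : ℝ) : squareWave y = if Int.fract y < 1 / 2 then 1 else -1 := by
  have h : squareWave y = squareWave (Int.fract y) := by
    have := squareWave_periodic.int_mul ⌊y⌋ (Int.fract y)
    rwa [mul_one, Int.fract_add_floor] at this
  rw [h]
  split_ifs with hf
  · exact squareWave_eq_one (Int.fract_nonneg y) hf
  · rw [← squareWave_periodic.sub_eq]
    exact squareWave_eq_neg_one (by linarith) (by linarith [Int.fract_lt_one y])

lemma ite_fundRep (p : ℝ × ℝ) : (if (fundRep p).2 < 1 / 2 then (1 : ℤ) else -1) = planeSign p := by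
  unfold planeSign fundRep
  by_cases h : Even ⌊2 * p.1⌋
  · rw [if_pos h, ← squareWave_eq_ite_fract, show squareWave p.1 = 1 from if_pos h, one_mul]
  · rw [if_neg h, ← squareWave_eq_ite_fract, show squareWave p.1 = -1 from if_neg h, neg_one_mul,
      ← squareWave_add_half, ← squareWave_periodic]
    congr 1
    ring

lemma sgn_mk (p : ℝ × ℝ) : sgn (QuotientAddGroup.mk p) = planeSign p := by
  have h : -(QuotientAddGroup.mk p : Y).out + p ∈ Lam :=
    QuotientAddGroup.eq.1 (Quotient.out_eq' (QuotientAddGroup.mk p : Y))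
  rw [sgn, ite_fundRep, ← planeSign_add_of_mem h, add_neg_cancel_left]

/-- The lift of `Ψ_{α,β}` to `ℝ² × ℤ²`. -/
noncomputable def planeMap (α β : ℝ) (s : (ℝ × ℝ) × (ℤ × ℤ)) : (ℝ × ℝ) × (ℤ × ℤ) :=
  (s.1 + (((s.2.2 * planeSign s.1 : ℤ) : ℝ) * α, ((s.2.1 * planeSign s.1 : ℤ) : ℝ) * β),
    (s.2.2 * planeSign s.1, s.2.1 * planeSign s.1))

section planeMap

variable (α β : ℝ)

lemma planeMap_semiconj_Psi :
    Function.Semiconj (Prod.map QuotientAddGroup.mk id : (ℝ × ℝ) × (ℤ × ℤ) → Y × (ℤ × ℤ))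
      (planeMap α β) (Psi α β) := fun s => by
  simp only [Psi, planeMap, Prod.map_apply, Prod.map_fst, Prod.map_snd, id_eq, sgn_mk,
    QuotientAddGroup.mk_add]

lemma planeMap_semiconj_coverMap :
    Function.Semiconj (Prod.map planeCover id : (ℝ × ℝ) × (ℤ × ℤ) → CoverState)
      (planeMap α β) (coverMap α β) := fun s => by
  simp [coverMap, planeMap, planeCover, planeSign]

lemma planeMap_translate {v : ℝ × ℝ} (hv : v ∈ Lam) :
    Function.Semiconj (Prod.map (· + v) id : (ℝ × ℝ) × (ℤ × ℤ) → (ℝ × ℝ) × (ℤ × ℤ))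
      (planeMap α β) (planeMap α β) := fun s => by
  simp only [planeMap, Prod.map_apply, Prod.map_fst, Prod.map_snd, id_eq, planeSign_add_of_mem hv,
    add_right_comm]

lemma planeCover_add (p q : ℝ × ℝ) : planeCover (p + q) = planeCover p + planeCover q := rfl

lemma planeCover_add_self_of_mem {v : ℝ × ℝ} (hv : v ∈ Lam) : planeCover (v + v) = 0 := by
  have hone : ((1 : ℝ) : UnitAddCircle) = 0 := AddCircle.coe_period 1
  unfold Lam at hv
  induction hv using AddSubgroup.closure_induction with
  | mem v hv =>
    rcases hv with rfl | rfl <;> simp only [planeCover, Prod.mk_add_mk, add_halves, ← neg_add,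
      AddCircle.coe_neg, hone, neg_zero] <;> rfl
  | zero => simp [planeCover]
  | add v w _ _ hv hw => rw [add_add_add_comm, planeCover_add, hv, hw, add_zero]
  | neg v _ hv =>
    rw [← neg_add, ← neg_eq_zero, ← hv]
    simp [planeCover]

lemma mem_Lam_of_planeCover_eq {p q : ℝ × ℝ} (h : planeCover p = planeCover q) : -p + q ∈ Lam := by
  have hg : (((1 : ℝ) / 2, (1 : ℝ) / 2) : ℝ × ℝ) ∈ Lam := AddSubgroup.subset_closure (by simp)
  have hg' : ((-((1 : ℝ) / 2), (1 : ℝ) / 2) : ℝ × ℝ) ∈ Lam := AddSubgroup.subset_closure (by simp)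
  obtain ⟨h1, h2⟩ := Prod.mk.injEq _ _ _ _ ▸ h
  obtain ⟨k, hk⟩ := (AddCircle.coe_eq_zero_iff (1 : ℝ)).1
    (show ((-p.1 + q.1 : ℝ) : UnitAddCircle) = 0 by simp [h1])
  obtain ⟨l, hl⟩ := (AddCircle.coe_eq_zero_iff (1 : ℝ)).1
    (show ((-p.2 + q.2 : ℝ) : UnitAddCircle) = 0 by simp [h2])
  convert Lam.add_mem (Lam.zsmul_mem hg (k + l)) (Lam.zsmul_mem hg' (l - k)) using 1
  ext
  · simp at hk ⊢
    rw [← hk]; ring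
  · simp at hl ⊢
    rw [← hl]; ring

lemma periodic_Psi_iff (p : ℝ × ℝ) (d : ℤ × ℤ) :
    (∃ n, 1 ≤ n ∧ (Psi α β)^[n] (QuotientAddGroup.mk p, d) = (QuotientAddGroup.mk p, d)) ↔
      ∃ n, 1 ≤ n ∧ (coverMap α β)^[n] (planeCover p, d) = (planeCover p, d) := by
  constructor
  · rintro ⟨n, hn, h⟩
    have e := ((planeMap_semiconj_Psi α β).iterate_right n) (p, d)
    rw [Prod.map_apply, Prod.map_apply, id_eq, id_eq, h] at e
    have e0 : (QuotientAddGroup.mk ((planeMap α β)^[n] (p, d)).1 : Y) = QuotientAddGroup.mk p :=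
      congrArg Prod.fst e
    obtain ⟨v, hv, hpv⟩ : ∃ v ∈ Lam, ((planeMap α β)^[n] (p, d)).1 = p + v :=
      ⟨-p + _, QuotientAddGroup.eq.1 e0.symm, (add_neg_cancel_left _ _).symm⟩
    have e1 : (planeMap α β)^[n] (p, d) = Prod.map (· + v) id (p, d) := Prod.ext hpv (congrArg Prod.snd e :)
    have e2 : (planeMap α β)^[n + n] (p, d) = (p + (v + v), d) := by
      rw [Function.iterate_add_apply, e1, ← ((planeMap_translate α β hv).iterate_right n) (p, d), e1]
      simp [add_assoc]
    refine ⟨n + n, by omega, ?_⟩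
    have e3 := ((planeMap_semiconj_coverMap α β).iterate_right (n + n)) (p, d)
    simp only [e2, Prod.map_apply, id_eq, planeCover_add p, planeCover_add_self_of_mem hv,
      add_zero] at e3
    exact e3.symm
  · rintro ⟨n, hn, h⟩
    refine ⟨n, hn, ?_⟩
    have e := ((planeMap_semiconj_coverMap α β).iterate_right n) (p, d)
    rw [Prod.map_apply, Prod.map_apply, id_eq, id_eq, h] at e
    have e1 : planeCover ((planeMap α β)^[n] (p, d)).1 = planeCover p := congrArg Prod.fst e
    have e3 := ((planeMap_semiconj_Psi α β).iterate_right n) (p, d)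
    simp only [Prod.map_apply, id_eq] at e3
    rw [← e3]
    exact Prod.ext (QuotientAddGroup.eq.2 (mem_Lam_of_planeCover_eq e1)) (congrArg Prod.snd e :)

end planeMap

lemma Mab_le (α β : ℝ) :
    Mab α β ≤ 2 * coverMeas (⋃ t, periodicUpTo (coverMap α β) t) := by
  set P := ⋃ t, periodicUpTo (coverMap α β) t
  set E := {p : Y × (ℤ × ℤ) | ∃ n : ℕ, 1 ≤ n ∧ (Psi α β)^[n] p = p}
  have hP : MeasurableSet P := .iUnion fun t =>
    measurableSet_periodicUpTo (measurePreserving_coverMap α β).measurable t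
  have hslice (d : ℤ × ℤ) : (QuotientAddGroup.mk : ℝ × ℝ → Y) ⁻¹' {q | (q, d) ∈ E} =
      planeCover ⁻¹' {x | (x, d) ∈ P} := by
    ext p
    refine (periodic_Psi_iff α β p d).trans ?_
    simp only [P, mem_preimage, mem_ofPred_eq, mem_iUnion, periodicUpTo]
    exact ⟨fun ⟨n, h1, h2⟩ => ⟨n, n, h1, le_rfl, h2⟩, fun ⟨_, n, h1, _, h2⟩ => ⟨n, h1, h2⟩⟩
  have hPd (d : ℤ × ℤ) : MeasurableSet {x | (x, d) ∈ P} := measurable_prodMk_right hP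
  have hEd (d : ℤ × ℤ) : MeasurableSet {q : Y | (q, d) ∈ E} := by
    have : MeasurableSet ((QuotientAddGroup.mk : ℝ × ℝ → Y) ⁻¹' {q | (q, d) ∈ E}) := by
      rw [hslice]
      exact measurable_planeCover (hPd d)
    exact this
  have hE : MeasurableSet E := by
    have : E = ⋃ d : ℤ × ℤ, {q | (q, d) ∈ E} ×ˢ {d} := by
      ext ⟨q, d⟩
      simp
    rw [this]
    exact .iUnion fun d => (hEd d).prod (measurableSet_singleton d)
  have hmk : Measurable (QuotientAddGroup.mk : ℝ × ℝ → Y) := fun _ h => h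
  have hle (d : ℤ × ℤ) : mY {q | (q, d) ∈ E} ≤ 2 * (volume.prod volume) {x | (x, d) ∈ P} := by
    rw [mY, Measure.map_apply hmk (hEd d), hslice, Measure.smul_apply, smul_eq_mul,
      ← (measurePreserving_planeCover 0).measure_preimage (hPd d).nullMeasurableSet]
    refine mul_le_mul_right (Measure.restrict_mono (prod_mono ?_ ?_) le_rfl _) _
    · exact Ico_subset_Ico_right (by norm_num)
    · rw [zero_add]
  have : SFinite mY := by unfold mY; infer_instance
  rw [Mab, lamMeas, coverMeas, prod_mN_apply _ hE, prod_mN_apply _ hP, mul_left_comm]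
  refine mul_le_mul_right ?_ _
  simp only [mul_add]
  gcongr <;> exact hle _

/-- For every `ε > 0` there exist irrational `α, β ∈ [0,1/2]` with
`M(α,β) < ε`. -/
theorem exists_irrational_Mab_lt (ε : ℝ≥0∞) (hε : 0 < ε) :
    ∃ α β : ℝ, α ∈ Set.Icc (0:ℝ) (1/2) ∧ β ∈ Set.Icc (0:ℝ) (1/2) ∧
      Irrational α ∧ Irrational β ∧ Mab α β < ε := by
  obtain ⟨N, hN⟩ := ENNReal.exists_inv_nat_lt (a := ε / 8) (ENNReal.div_pos hε.ne' (by simp)).ne'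
  have hN1 : 1 ≤ N := by
    rcases N with _ | N
    · simp at hN
    · omega
  obtain ⟨α, hα, β, hβ, hαi, hβi, h⟩ := exists_irrational_coverMeas_le hN1
  refine ⟨α, β, hα, hβ, hαi, hβi, ?_⟩
  have hN0 : (0 : ℝ) < N := by exact_mod_cast hN1
  calc Mab α β ≤ 2 * coverMeas (⋃ t, periodicUpTo (coverMap α β) t) := Mab_le α β
    _ ≤ 2 * ENNReal.ofReal (4 / N) := by
      rw [(periodicUpTo_mono _).measure_iUnion]
      refine mul_le_mul_right (iSup_le fun t => ?_) _
      rw [← ofReal_measureReal]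
      exact ENNReal.ofReal_le_ofReal (h t)
    _ = (N : ℝ≥0∞)⁻¹ * 8 := by
      rw [ENNReal.ofReal_div_of_pos hN0, ENNReal.ofReal_natCast, ENNReal.ofReal_ofNat,
        div_eq_mul_inv, ← mul_assoc, mul_comm]
      norm_num
    _ < ε := (ENNReal.lt_div_iff_mul_lt (by simp) (by simp)).1 hN
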